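/- For every integer m ≥ 1 there exists a constant C₁ > 0 depending only on m with the following property. Let n ≥ 1, let Δ ⊆ Δ' be open polydiscs centered at 0 in ℂⁿ, let ℳ ⊆ ℕⁿ be a co-ideal, let K ≥ 1, and suppose X ⊆ ℂⁿ admits decomposition with respect to (ℳ, Δ, Δ') with norm K. Let e ≥ 1 satisfy #{α ∈ ℳ : |α| = k} ≤ e·L(m,k) for all k ∈ ℕ. Let 0 < δ < 1/2 and let D be an open polydisc centered at 0 with D^δ := {δ^{−1}·z : z ∈ D} ⊆ Δ. Let M ≥ 2, let f₁,…,f_{m+1} be holomorphic on a neighborhood of the closure of Δ' with sup_{Δ'} |f_i| ≤ M for each i, and set Y := {(f₁(z),…,f_{m+1}(z)) : z ∈ X ∩ D} ⊆ ℂ^{m+1}. Let H ≥ 2 be an integer and let d be an integer with d ≥ e. If −log δ > C₁ · (d^{−1}·log(K·e) + log M + log H) · (e/d)^{1/m}, then there exists a nonzero polynomial P ∈ ℂ[X₁,…,X_{m+1}] of total degree at most d vanishing at every point of Y(ℚ,H). -/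

import Mathlib

open scoped BigOperators

/-- The open polydisc in `ℂⁿ` centered at `0` of polyradius `r`. -/
def polydisc0 {n : ℕ} (r : Fin n → ℝ) : Set (Fin n → ℂ) :=
  {z | ∀ i, ‖z i‖ < r i}

/-- A co-ideal of multi-indices: downward closed under the componentwise order. -/
def IsCoideal {n : ℕ} (ℳ : Set (Fin n → ℕ)) : Prop :=
  ∀ α ∈ ℳ, ∀ β : Fin n → ℕ, (∀ i, β i ≤ α i) → β ∈ ℳ

/-- The monomial `z ^ α`. -/
def mon {n : ℕ} (α : Fin n → ℕ) (z : Fin n → ℂ) : ℂ := ∏ i, z i ^ α i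

/-- `L n k`: the number of monomials of degree exactly `k` in `n` variables. -/
def L (n k : ℕ) : ℕ := (n + k - 1).choose (n - 1)

/-- The data `(c, Q)` witnesses the decomposition of `F` with respect to
`(ℳ, Δ, Δ')` with norm `K`: `Q` is holomorphic on `Δ`, the series
`∑_{α ∈ ℳ} c_α z^α` converges on `Δ`, `F = ∑_{α ∈ ℳ} c_α z^α + Q` on `Δ`,
`Q` vanishes identically on `X ∩ Δ`, and
`sup_Δ ‖c_α z^α‖ ≤ K ⬝ sup_{Δ'} ‖F‖` for every `α ∈ ℳ`. -/
def IsDecompWitness {n : ℕ} (X : Set (Fin n → ℂ)) (ℳ : Set (Fin n → ℕ))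
    (Δ Δ' : Set (Fin n → ℂ)) (K : ℝ) (F : (Fin n → ℂ) → ℂ)
    (c : (Fin n → ℕ) → ℂ) (Q : (Fin n → ℂ) → ℂ) : Prop :=
  DifferentiableOn ℂ Q Δ ∧
  (∀ z ∈ Δ, Summable fun α : ℳ => c α.1 * mon α.1 z) ∧
  (∀ z ∈ Δ, F z = (∑' α : ℳ, c α.1 * mon α.1 z) + Q z) ∧
  (∀ z ∈ X ∩ Δ, Q z = 0) ∧
  (∀ α ∈ ℳ, ∀ z ∈ Δ, ‖c α * mon α z‖ ≤ K * sSup ((fun x => ‖F x‖) '' Δ'))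

/-- `X` admits decomposition with respect to `(ℳ, Δ, Δ')` with norm `K`:
every `F` holomorphic on a neighborhood of the closure of `Δ'` admits a
decomposition witness. -/
def AdmitsDecomposition {n : ℕ} (X : Set (Fin n → ℂ)) (ℳ : Set (Fin n → ℕ))
    (Δ Δ' : Set (Fin n → ℂ)) (K : ℝ) : Prop :=
  ∀ F : (Fin n → ℂ) → ℂ,
    (∃ V : Set (Fin n → ℂ), IsOpen V ∧ closure Δ' ⊆ V ∧ DifferentiableOn ℂ F V) →
    ∃ (c : (Fin n → ℕ) → ℂ) (Q : (Fin n → ℂ) → ℂ), IsDecompWitness X ℳ Δ Δ' K F c Q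

/-- The height of a rational number `a/b` in lowest terms (`b > 0`) is `max |a| b`. -/
def ratHeight (q : ℚ) : ℕ := max q.num.natAbs q.den

theorem finite_setOf_degree_eq {n : ℕ} (ℳ : Set (Fin n → ℕ)) (k : ℕ) :
    {α ∈ ℳ | (∑ i, α i) = k}.Finite := by
  refine (Set.finite_Icc (0 : Fin n → ℕ) fun _ => k).subset fun α hα => ?_
  refine ⟨fun i => Nat.zero_le _, fun i => ?_⟩
  rw [← hα.2]
  exact Finset.single_le_sum (fun _ _ => Nat.zero_le _) (Finset.mem_univ i)

theorem L_eq {m : ℕ} (hm : 1 ≤ m) (k : ℕ) : L m k = (k + (m - 1)).choose (m - 1) := by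
  unfold L
  congr 1
  omega

theorem card_filter_degree_le {n m e : ℕ} {ℳ : Set (Fin n → ℕ)}
    (hcount : ∀ k : ℕ, ({α ∈ ℳ | (∑ i, α i) = k}).ncard ≤ e * L m k)
    (s : Finset (Fin n → ℕ)) (hs : ↑s ⊆ ℳ) (k : ℕ) :
    (s.filter fun α => (∑ i, α i) = k).card ≤ e * L m k := by
  refine le_trans ?_ (hcount k)
  rw [← Set.ncard_coe_finset]
  refine Set.ncard_le_ncard (fun α hα => ?_) (finite_setOf_degree_eq ℳ k)
  rw [Finset.coe_filter] at hα
  exact ⟨hs hα.1, hα.2⟩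

theorem sum_pow_degree_le {n m e : ℕ} (hm : 1 ≤ m) {ℳ : Set (Fin n → ℕ)}
    (hcount : ∀ k : ℕ, ({α ∈ ℳ | (∑ i, α i) = k}).ncard ≤ e * L m k)
    {ε : ℝ} (hε₀ : 0 ≤ ε) (hε₁ : ε ≤ 3 / 4) (s : Finset (Fin n → ℕ)) (hs : ↑s ⊆ ℳ) :
    ∑ α ∈ s, ε ^ (∑ i, α i) ≤ e * 4 ^ m := by
  classical
  have hsum : HasSum (fun k : ℕ => (L m k : ℝ) * (3 / 4 : ℝ) ^ k) (4 ^ m) := by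
    have h := hasSum_choose_mul_geometric_of_norm_lt_one (𝕜 := ℝ) (m - 1)
      (r := 3 / 4) (by norm_num)
    simp_rw [L_eq hm]
    have hval : 1 / (1 - 3 / 4 : ℝ) ^ (m - 1 + 1) = 4 ^ m := by
      rw [Nat.sub_add_cancel hm, one_div, ← inv_pow]
      norm_num
    rwa [hval] at h
  calc ∑ α ∈ s, ε ^ (∑ i, α i)
      = ∑ k ∈ s.image fun α => ∑ i, α i, ∑ α ∈ s with ∑ i, α i = k, ε ^ (∑ i, α i) :=
        (Finset.sum_fiberwise_of_maps_to (fun α hα => Finset.mem_image_of_mem _ hα) _).symm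
    _ ≤ ∑ k ∈ s.image fun α => ∑ i, α i, e * ((L m k : ℝ) * (3 / 4 : ℝ) ^ k) := by
        refine Finset.sum_le_sum fun k _ => ?_
        rw [Finset.sum_congr rfl (g := fun _ => ε ^ k)
          (fun α hα => by rw [(Finset.mem_filter.mp hα).2]), Finset.sum_const, nsmul_eq_mul,
          ← mul_assoc]
        have := card_filter_degree_le hcount s hs k
        gcongr
        exact_mod_cast this
    _ = e * ∑ k ∈ s.image fun α => ∑ i, α i, (L m k : ℝ) * (3 / 4 : ℝ) ^ k :=
        (Finset.mul_sum _ _ _).symm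
    _ ≤ e * 4 ^ m := by
        gcongr
        exact sum_le_hasSum _ (fun k _ => by positivity) hsum

theorem sum_range_L {m : ℕ} (hm : 1 ≤ m) (k : ℕ) (hk : 1 ≤ k) :
    ∑ j ∈ Finset.range k, L m j = (k - 1 + m).choose m := by
  obtain ⟨k, rfl⟩ := Nat.exists_eq_add_of_le' hk
  obtain ⟨m, rfl⟩ := Nat.exists_eq_add_of_le' hm
  simp_rw [L_eq hm]
  have := Nat.sum_range_add_choose k m
  simpa [add_assoc] using this

theorem exists_finset_degree_lt {n m e : ℕ} {ℳ : Set (Fin n → ℕ)}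
    (hcount : ∀ k : ℕ, ({α ∈ ℳ | (∑ i, α i) = k}).ncard ≤ e * L m k) (k₀ : ℕ) :
    ∃ s : Finset (Fin n → ℕ), (∀ α, α ∈ s ↔ α ∈ ℳ ∧ ∑ i, α i < k₀) ∧
      s.card ≤ e * ∑ k ∈ Finset.range k₀, L m k := by
  classical
  have hfin : {α ∈ ℳ | (∑ i, α i) < k₀}.Finite := by
    refine ((Finset.range k₀).finite_toSet.biUnion
      fun k _ => finite_setOf_degree_eq ℳ k).subset fun α hα => ?_
    simpa using hα
  refine ⟨hfin.toFinset, fun α => by simp, ?_⟩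
  rw [Finset.card_eq_sum_card_fiberwise (f := fun α => ∑ i, α i) (t := Finset.range k₀)
    (fun α hα => by simpa using (hfin.mem_toFinset.mp hα).2), Finset.mul_sum]
  exact Finset.sum_le_sum fun k _ => card_filter_degree_le hcount _
    (fun α hα => (hfin.mem_toFinset.mp hα).1) k

theorem norm_sum_high_le {n m e : ℕ} (hm : 1 ≤ m) {ℳ : Set (Fin n → ℕ)}
    (hcount : ∀ k : ℕ, ({α ∈ ℳ | (∑ i, α i) = k}).ncard ≤ e * L m k)
    {ε A : ℝ} (hε₀ : 0 ≤ ε) (hε₁ : ε ≤ 3 / 4) (hA : 0 ≤ A) {a : (Fin n → ℕ) → ℂ} {k₀ : ℕ}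
    (ha : ∀ α ∈ ℳ, ‖a α‖ ≤ A * (ε ^ (∑ i, α i)) ^ 2)
    (s : Finset (Fin n → ℕ)) (hs : ↑s ⊆ ℳ) (hk₀ : ∀ α ∈ s, k₀ ≤ ∑ i, α i) :
    ‖∑ α ∈ s, a α‖ ≤ A * (e * 4 ^ m) * ε ^ k₀ := by
  calc ‖∑ α ∈ s, a α‖ ≤ ∑ α ∈ s, A * ε ^ k₀ * ε ^ (∑ i, α i) := by
        refine norm_sum_le_of_le _ fun α hα => (ha α (hs hα)).trans ?_
        rw [sq, ← mul_assoc]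
        have := pow_le_pow_of_le_one hε₀ (by linarith) (hk₀ α hα)
        gcongr
    _ = A * ε ^ k₀ * ∑ α ∈ s, ε ^ (∑ i, α i) := (Finset.mul_sum _ _ _).symm
    _ ≤ A * ε ^ k₀ * (e * 4 ^ m) := by
        gcongr
        exact sum_pow_degree_le hm hcount hε₀ hε₁ s hs
    _ = _ := by ring

theorem norm_tsum_sub_sum_low_le {n m e : ℕ} (hm : 1 ≤ m) {ℳ : Set (Fin n → ℕ)}
    (hcount : ∀ k : ℕ, ({α ∈ ℳ | (∑ i, α i) = k}).ncard ≤ e * L m k)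
    {ε A : ℝ} (hε₀ : 0 ≤ ε) (hε₁ : ε ≤ 3 / 4) (hA : 0 ≤ A) {a : (Fin n → ℕ) → ℂ} {k₀ : ℕ}
    (ha : ∀ α ∈ ℳ, ‖a α‖ ≤ A * (ε ^ (∑ i, α i)) ^ 2) (hsum : Summable fun α : ℳ => a α)
    (s : Finset (Fin n → ℕ)) (hs : ∀ α, α ∈ s ↔ α ∈ ℳ ∧ ∑ i, α i < k₀) :
    ‖(∑' α : ℳ, a α) - ∑ α ∈ s, a α‖ ≤ A * (e * 4 ^ m) * ε ^ k₀ := by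
  classical
  let s' : Finset ℳ := s.subtype (· ∈ ℳ)
  have hlim := (hsum.hasSum.sub_const (∑ α ∈ s, a α)).norm
  refine le_of_tendsto hlim ?_
  filter_upwards [Filter.eventually_ge_atTop s'] with t ht
  have hst : s ⊆ t.map (Function.Embedding.subtype _) := by
    intro α hα
    have hαM := ((hs α).mp hα).1
    exact Finset.mem_map.mpr ⟨⟨α, hαM⟩, ht (Finset.mem_subtype.mpr hα), rfl⟩
  have heq : ∑ α ∈ t, a α - ∑ α ∈ s, a α =
      ∑ α ∈ t.map (Function.Embedding.subtype _) \ s, a α := by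
    rw [Finset.sum_sdiff_eq_sub hst, Finset.sum_map]
    rfl
  rw [heq]
  have hsub : ∀ α ∈ t.map (Function.Embedding.subtype _) \ s, α ∈ ℳ ∧ α ∉ s := by
    intro α hα
    rw [Finset.mem_sdiff, Finset.mem_map] at hα
    obtain ⟨⟨x, -, rfl⟩, hx⟩ := hα
    exact ⟨x.2, hx⟩
  refine norm_sum_high_le hm hcount hε₀ hε₁ hA ha _ (fun α hα => (hsub α hα).1) fun α hα => ?_
  have h := hsub α hα
  rw [hs] at h
  by_contra hlt
  exact h.2 ⟨h.1, by omega⟩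

theorem mon_smul {n : ℕ} (t : ℂ) (α : Fin n → ℕ) (z : Fin n → ℂ) :
    mon α (t • z) = t ^ (∑ i, α i) * mon α z := by
  simp [mon, mul_pow, Finset.prod_mul_distrib, Finset.prod_pow_eq_pow_sum]

theorem norm_mul_mon_le_of_smul_mem {n : ℕ} {Δ : Set (Fin n → ℂ)} {δ A : ℝ} (hδ : 0 < δ)
    {c : ℂ} {α : Fin n → ℕ} (hc : ∀ z ∈ Δ, ‖c * mon α z‖ ≤ A) {z : Fin n → ℂ}
    (hz : (δ⁻¹ : ℂ) • z ∈ Δ) : ‖c * mon α z‖ ≤ A * δ ^ (∑ i, α i) := by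
  have h := hc _ hz
  rw [mon_smul, mul_left_comm, norm_mul, norm_pow, norm_inv, Complex.norm_real,
    Real.norm_of_nonneg hδ.le, inv_pow, inv_mul_le_iff₀ (by positivity)] at h
  rwa [mul_comm A]

/-- Perturbation bound for determinants of matrices of small rank. -/
theorem norm_det_add_le_of_rank_le {ι : Type*} [Fintype ι] [DecidableEq ι]
    (T E : Matrix ι ι ℂ) {B η : ℝ} {ρ : ℕ} (hη₀ : 0 ≤ η) (hη₁ : η ≤ 1)
    (hT : ∀ i j, ‖T i j‖ ≤ B) (hE : ∀ i j, ‖E i j‖ ≤ B * η) (hrank : T.rank ≤ ρ) :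
    ‖(T + E).det‖ ≤
      2 ^ Fintype.card ι * ((Fintype.card ι).factorial * B ^ Fintype.card ι *
        η ^ (Fintype.card ι - ρ)) := by
  classical
  rcases isEmpty_or_nonempty ι with hι | ⟨⟨i₀⟩⟩
  · simp
  have hB : 0 ≤ B := (norm_nonneg _).trans (hT i₀ i₀)
  have hexp : (T + E).det =
      ∑ s : Finset ι, Matrix.det (Matrix.of fun i j => if i ∈ s then T i j else E i j) := by
    refine ((Matrix.detRowAlternating (R := ℂ) (n := ι)).toMultilinearMap.map_add_univ
      T.row E.row).trans (Finset.sum_congr rfl fun s _ => congrArg Matrix.det ?_)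
    ext i j
    by_cases h : i ∈ s <;> simp [Finset.piecewise, Matrix.row, h]
  have hterm : ∀ s : Finset ι,
      ‖Matrix.det (Matrix.of (fun i j => if i ∈ s then T i j else E i j))‖ ≤
      (Fintype.card ι).factorial * B ^ Fintype.card ι * η ^ (Fintype.card ι - ρ) := by
    intro s
    by_cases hs : ρ < s.card
    · rw [Matrix.det_eq_zero_of_not_linearIndependent_rows]
      · rw [norm_zero]; positivity
      · intro hli
        have hsub : LinearIndependent ℂ (fun i : s => T.row i) := by
          have := hli.comp (fun i : s => (i : ι)) Subtype.val_injective
          have heq : (fun i : s => T.row i) = (fun i => Matrix.of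
              (fun i j => if i ∈ s then T i j else E i j) i) ∘ fun i : s => (i : ι) := by
            ext i j
            simp [Matrix.row]
          rw [heq]
          exact this
        have hcard : Fintype.card s ≤ T.rank := by
          rw [Matrix.rank_eq_finrank_span_row, ← finrank_span_eq_card hsub]
          apply Submodule.finrank_mono
          apply Submodule.span_mono
          rintro _ ⟨i, rfl⟩
          exact ⟨i, rfl⟩
        rw [Fintype.card_coe] at hcard
        omega
    · rw [Matrix.det_apply]
      refine (norm_sum_le _ _).trans ?_
      have hprod : ∀ σ ∈ (Finset.univ : Finset (Equiv.Perm ι)),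
          ‖Equiv.Perm.sign σ • ∏ i, Matrix.of (fun i j => if i ∈ s then T i j else E i j) (σ i) i‖ ≤
          B ^ Fintype.card ι * η ^ (Fintype.card ι - ρ) := by
        intro σ _
        have h1 : ‖Equiv.Perm.sign σ • ∏ i,
            Matrix.of (fun i j => if i ∈ s then T i j else E i j) (σ i) i‖ =
            ∏ i, ‖Matrix.of (fun i j => if i ∈ s then T i j else E i j) (σ i) i‖ := by
          rcases Int.units_eq_one_or (Equiv.Perm.sign σ) with h | h <;> simp [h, norm_prod]
        have h2 : ∏ i, ‖Matrix.of (fun i j => if i ∈ s then T i j else E i j) (σ i) i‖ ≤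
            ∏ i, (B * if σ i ∈ s then 1 else η) := by
          refine Finset.prod_le_prod (fun _ _ => norm_nonneg _) fun i _ => ?_
          by_cases h : σ i ∈ s
          · simpa [h] using hT (σ i) i
          · simpa [h] using hE (σ i) i
        rw [h1]
        refine h2.trans ?_
        rw [Equiv.prod_comp σ (fun i => B * if i ∈ s then 1 else η), Finset.prod_mul_distrib,
          Finset.prod_const, Finset.card_univ]
        gcongr
        rw [Finset.prod_ite, Finset.prod_const_one, one_mul, Finset.prod_const]
        refine pow_le_pow_of_le_one hη₀ hη₁ ?_
        have : (Finset.univ.filter fun i => i ∉ s) = sᶜ := by ext; simp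
        rw [this, Finset.card_compl]
        omega
      refine (Finset.sum_le_card_nsmul _ _ _ hprod).trans_eq ?_
      rw [Finset.card_univ, Fintype.card_perm, nsmul_eq_mul, mul_assoc]
  rw [hexp]
  refine (norm_sum_le _ _).trans ((Finset.sum_le_card_nsmul _ _ _ fun s _ => hterm s).trans_eq ?_)
  rw [Finset.card_univ, Fintype.card_finset, nsmul_eq_mul]
  push_cast
  ring

/-- A nonzero determinant of monomials in rationals of bounded height is bounded below. -/
theorem one_le_norm_det_mul_of_ratHeight_le {ι κ : Type*} [Fintype ι] [DecidableEq ι]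
    [Fintype κ] (q : ι → κ → ℚ) (β : ι → κ → ℕ) {H d : ℕ}
    (hq : ∀ j k, ratHeight (q j k) ≤ H) (hβ : ∀ i k, β i k ≤ d)
    (hdet : (Matrix.of fun j i => ∏ k, (q j k : ℂ) ^ β i k).det ≠ 0) :
    1 ≤ ‖(Matrix.of fun j i => ∏ k, (q j k : ℂ) ^ β i k).det‖ *
      ((H : ℝ) ^ (Fintype.card κ * d)) ^ Fintype.card ι := by
  set A : Matrix ι ι ℂ := Matrix.of fun j i => ∏ k, (q j k : ℂ) ^ β i k with hA
  let N : ι → ℕ := fun j => ∏ k, (q j k).den ^ d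
  let Z : Matrix ι ι ℤ := Matrix.of fun j i =>
    ∏ k, ((q j k).num ^ β i k * ((q j k).den : ℤ) ^ (d - β i k))
  have hZ : (Z.det : ℂ) = (∏ j, (N j : ℂ)) * A.det := by
    rw [← Matrix.det_mul_column, Int.cast_det]
    congr 1
    ext j i
    simp only [Z, N, hA, Matrix.map_apply, Matrix.of_apply, Int.cast_prod, Nat.cast_prod,
      ← Finset.prod_mul_distrib]
    refine Finset.prod_congr rfl fun k _ => ?_
    have hden : ((q j k).den : ℂ) ≠ 0 := by exact_mod_cast (q j k).den_ne_zero
    have hnum : ((q j k).num : ℂ) = (q j k : ℂ) * ((q j k).den : ℂ) := by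
      rw [Rat.cast_def (q j k)]; field_simp
    push_cast
    rw [hnum, mul_pow, mul_assoc, ← pow_add, Nat.add_sub_cancel' (hβ i k)]
    ring
  have hN : ∀ j, N j ≤ H ^ (Fintype.card κ * d) := by
    intro j
    have : N j ≤ ∏ _k : κ, H ^ d := Finset.prod_le_prod' fun k _ =>
      Nat.pow_le_pow_left ((le_max_right _ _).trans (hq j k)) d
    rwa [Finset.prod_const, Finset.card_univ, ← pow_mul, mul_comm d] at this
  have hN0 : ∀ j, (N j : ℂ) ≠ 0 := fun j => by
    exact_mod_cast Finset.prod_ne_zero_iff.mpr fun k _ => pow_ne_zero _ (q j k).den_ne_zero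
  have hZ0 : Z.det ≠ 0 := by
    intro h
    rw [h, Int.cast_zero] at hZ
    exact mul_ne_zero (Finset.prod_ne_zero_iff.mpr fun j _ => hN0 j) hdet hZ.symm
  have h1 : (1 : ℝ) ≤ ‖(Z.det : ℂ)‖ := by
    rw [Complex.norm_intCast]
    exact_mod_cast Int.one_le_abs hZ0
  rw [hZ, norm_mul, mul_comm] at h1
  refine h1.trans (mul_le_mul_of_nonneg_left ?_ (norm_nonneg _))
  rw [norm_prod, ← Finset.card_univ (α := ι), ← Finset.prod_const]
  refine Finset.prod_le_prod (fun _ _ => norm_nonneg _) fun j _ => ?_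
  rw [Complex.norm_natCast]
  exact_mod_cast hN j

/-- A finite family of functions on `σ` is either linearly dependent or admits an interpolation
determinant that does not vanish. -/
theorem exists_relation_or_det_ne_zero {ι σ : Type*} [Fintype ι] [DecidableEq ι]
    (g : ι → σ → ℂ) :
    (∃ a : ι → ℂ, a ≠ 0 ∧ ∀ z, ∑ i, a i * g i z = 0) ∨
      ∃ p : ι → σ, (Matrix.of fun j i => g i (p j)).det ≠ 0 := by
  classical
  let v : σ → ι → ℂ := fun z i => g i z
  by_cases hspan : Submodule.span ℂ (Set.range v) = ⊤
  · right
    obtain ⟨κ, a, -, hsp, hli⟩ := exists_linearIndependent' ℂ v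
    let b := Module.Basis.mk hli (by rw [hsp, hspan])
    let c := b.reindex (b.indexEquiv (Pi.basisFun ℂ ι))
    refine ⟨fun j => a ((b.indexEquiv (Pi.basisFun ℂ ι)).symm j), ?_⟩
    have hc := c.linearIndependent
    have : c = (Matrix.of fun j i => g i (a ((b.indexEquiv (Pi.basisFun ℂ ι)).symm j))).row := by
      ext j i
      simp [c, b, v, Matrix.row]
    rw [this] at hc
    exact ((Matrix.isUnit_iff_isUnit_det _).mp
      (Matrix.linearIndependent_rows_iff_isUnit.mp hc)).ne_zero
  · left
    obtain ⟨φ, hφ0, hφ⟩ := Submodule.exists_le_ker_of_lt_top _ (lt_top_iff_ne_top.mpr hspan)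
    refine ⟨fun i => φ (Pi.single i 1), ?_, fun z => ?_⟩
    · intro h
      apply hφ0
      ext i
      simpa using congrFun h i
    · have : φ (v z) = 0 := hφ (Submodule.subset_span ⟨z, rfl⟩)
      rw [← this, LinearMap.pi_apply_eq_sum_univ φ (v z)]
      refine Finset.sum_congr rfl fun i _ => ?_
      have hsingle : (Pi.single i 1 : ι → ℂ) = fun j => if i = j then 1 else 0 := by
        ext j
        simp [Pi.single_apply, eq_comm]
      rw [← hsingle]
      exact mul_comm _ _

theorem norm_det_le_of_admitsDecomposition {n m e : ℕ} (hm : 1 ≤ m) {X : Set (Fin n → ℂ)}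
    {ℳ : Set (Fin n → ℕ)} {Δ Δ' : Set (Fin n → ℂ)} {K : ℝ} (hK : 0 ≤ K) (hΔ' : Δ'.Nonempty)
    (hX : AdmitsDecomposition X ℳ Δ Δ' K)
    (hcount : ∀ k : ℕ, ({α ∈ ℳ | (∑ i, α i) = k}).ncard ≤ e * L m k)
    {δ : ℝ} (hδ₀ : 0 < δ) (hδ₁ : δ < 1 / 2) {ι : Type*} [Fintype ι] [DecidableEq ι]
    (g : ι → (Fin n → ℂ) → ℂ)
    (hg : ∀ i, ∃ V : Set (Fin n → ℂ), IsOpen V ∧ closure Δ' ⊆ V ∧ DifferentiableOn ℂ (g i) V)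
    {S : ℝ} (hS : 0 ≤ S) (hgS : ∀ i, ∀ z ∈ Δ', ‖g i z‖ ≤ S) (p : ι → Fin n → ℂ)
    (hpX : ∀ j, p j ∈ X ∩ Δ) (hpΔ : ∀ j, (δ⁻¹ : ℂ) • p j ∈ Δ) (k₀ : ℕ) :
    ‖(Matrix.of fun j i => g i (p j)).det‖ ≤
      2 ^ Fintype.card ι * ((Fintype.card ι).factorial *
        (K * S * (e * 4 ^ m)) ^ Fintype.card ι *
          (√δ ^ k₀) ^ (Fintype.card ι - e * ∑ k ∈ Finset.range k₀, L m k)) := by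
  have hε₁ : √δ ≤ 3 / 4 := Real.sqrt_le_iff.mpr ⟨by norm_num, by linarith⟩
  choose c Q hw using fun i => hX (g i) (hg i)
  obtain ⟨s, hs, hcard⟩ := exists_finset_degree_lt hcount k₀
  have hterm : ∀ i j, ∀ α ∈ ℳ,
      ‖c i α * mon α (p j)‖ ≤ K * S * (√δ ^ (∑ i, α i)) ^ 2 := by
    intro i j α hα
    have hsup : sSup ((fun x => ‖g i x‖) '' Δ') ≤ S :=
      csSup_le (hΔ'.image _) (by rintro _ ⟨z, hz, rfl⟩; exact hgS i z hz)
    rw [← pow_mul, mul_comm _ 2, pow_mul, Real.sq_sqrt hδ₀.le]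
    exact norm_mul_mon_le_of_smul_mem hδ₀ (fun z hz =>
      ((hw i).2.2.2.2 α hα z hz).trans (mul_le_mul_of_nonneg_left hsup hK)) (hpΔ j)
  let U : Matrix ι s ℂ := Matrix.of fun j α => mon α.1 (p j)
  let W : Matrix s ι ℂ := Matrix.of fun α i => c i α.1
  have hT : ∀ j i, (U * W) j i = ∑ α ∈ s, c i α * mon α (p j) := by
    intro j i
    rw [Matrix.mul_apply, ← Finset.sum_coe_sort s]
    exact Finset.sum_congr rfl fun α _ => mul_comm _ _
  have hval : ∀ j i, g i (p j) = ∑' α : ℳ, c i α.1 * mon α.1 (p j) := by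
    intro j i
    rw [(hw i).2.2.1 _ (hpX j).2, (hw i).2.2.2.1 _ (hpX j), add_zero]
  have hKS : 0 ≤ K * S := mul_nonneg hK hS
  have hmain := norm_det_add_le_of_rank_le (U * W) ((Matrix.of fun j i => g i (p j)) - U * W)
    (B := K * S * (e * 4 ^ m)) (η := √δ ^ k₀) (by positivity)
    (pow_le_one₀ (by positivity) (by linarith)) (fun j i => ?_) (fun j i => ?_)
    ((Matrix.rank_mul_le_left U W).trans ((Matrix.rank_le_card_width U).trans
      ((Fintype.card_coe s).trans_le hcard)))
  · rwa [add_sub_cancel] at hmain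
  · rw [hT]
    simpa using norm_sum_high_le (k₀ := 0) hm hcount (Real.sqrt_nonneg δ) hε₁ hKS (hterm i j) s
      (fun α hα => ((hs α).mp hα).1) (fun _ _ => Nat.zero_le _)
  · rw [Matrix.sub_apply, hT, Matrix.of_apply, hval]
    exact norm_tsum_sub_sum_low_le hm hcount (Real.sqrt_nonneg δ) hε₁ hKS (hterm i j)
      ((hw i).2.1 _ (hpX j).2) s hs

theorem add_choose_le_succ_pow (k m : ℕ) : (k + m).choose m ≤ (k + 1) ^ m := by
  induction m with
  | zero => simp
  | succ m ih =>
    have h := Nat.add_one_mul_choose_eq (k + m) m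
    refine Nat.le_of_mul_le_mul_right (c := m + 1) ?_ m.succ_pos
    rw [← add_assoc, ← h, pow_succ]
    nlinarith [Nat.zero_le (k * m)]

theorem succ_pow_le_factorial_mul_choose (d m : ℕ) :
    (d + 1) ^ m ≤ m.factorial * (d + m).choose m := by
  rw [← Nat.descFactorial_eq_factorial_mul_choose]
  refine le_trans (le_of_eq ?_) (Nat.pow_sub_le_descFactorial (d + m) m)
  congr 1
  omega

theorem exists_truncation_degree {m d e : ℕ} (hm : 1 ≤ m) (he : 1 ≤ e) (hde : e ≤ d) :
    ∃ k₀ : ℕ, 2 * (e * ∑ k ∈ Finset.range k₀, L m k) ≤ (d + (m + 1)).choose (m + 1) ∧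
      (d : ℝ) * ((d : ℝ) / e) ^ (1 / (m : ℝ)) ≤ 4 * (m + 1).factorial * k₀ := by
  have he' : (0 : ℝ) < e := by exact_mod_cast he
  have hd' : (0 : ℝ) < d := by exact_mod_cast he.trans hde
  set x : ℝ := (d : ℝ) * ((d : ℝ) / e) ^ (1 / (m : ℝ)) with hx
  have hx0 : 0 < x := by positivity
  have hxm : x ^ m = (d : ℝ) ^ (m + 1) / e := by
    rw [hx, mul_pow, ← Real.rpow_natCast (_ ^ _) m, ← Real.rpow_mul (by positivity),
      one_div_mul_cancel (by positivity), Real.rpow_one, pow_succ]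
    ring
  set N : ℝ := 2 * (m + 1).factorial with hN
  have hN1 : 1 ≤ N := by
    have : (1 : ℝ) ≤ (m + 1).factorial := by exact_mod_cast Nat.factorial_pos _
    linarith
  rcases lt_or_ge (x / N) 1 with hlt | hge
  · refine ⟨1, ?_, ?_⟩
    · have hL : L m 0 = 1 := by rw [L_eq hm]; simp
      rw [Finset.sum_range_one, hL, mul_one]
      have h2 : (d + 2).choose 2 ≤ (d + (m + 1)).choose (m + 1) := by
        rw [← Nat.choose_symm_add (a := d) (b := 2), ← Nat.choose_symm_add (a := d) (b := m + 1)]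
        exact Nat.choose_le_choose d (by omega)
      have h4 := Nat.add_one_mul_choose_eq (d + 1) 1
      rw [Nat.choose_one_right] at h4
      have h5 : 2 * d ≤ (d + 2).choose 2 := by
        rcases d with _ | d
        · simp
        · nlinarith
      omega
    · rw [div_lt_one (by linarith)] at hlt
      push_cast
      linarith
  · refine ⟨⌊x / N⌋₊, ?_, ?_⟩
    · have hk1 : 1 ≤ ⌊x / N⌋₊ := Nat.one_le_floor_iff _ |>.mpr hge
      set k := ⌊x / N⌋₊ with hk
      have hkx : (k : ℝ) ≤ x / N := Nat.floor_le (by positivity)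
      rw [sum_range_L hm k hk1]
      have h1 := add_choose_le_succ_pow (k - 1) m
      rw [Nat.sub_add_cancel hk1] at h1
      have h2 : (k : ℝ) ^ m * (N * e) ≤ (d : ℝ) ^ (m + 1) := by
        calc (k : ℝ) ^ m * (N * e) ≤ (x / N) ^ m * (N * e) := by gcongr
          _ = (d : ℝ) ^ (m + 1) * (N / N ^ m) := by rw [div_pow, hxm]; field_simp
          _ ≤ (d : ℝ) ^ (m + 1) * 1 := by
              gcongr
              exact div_le_one_of_le₀ (le_self_pow₀ hN1 (by omega)) (by positivity)
          _ = _ := mul_one _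
      have h3 : k ^ m * (2 * (m + 1).factorial * e) ≤ d ^ (m + 1) := by
        rw [hN] at h2
        exact_mod_cast h2
      have h4 := succ_pow_le_factorial_mul_choose d (m + 1)
      have h5 : d ^ (m + 1) ≤ (d + 1) ^ (m + 1) := Nat.pow_le_pow_left (by omega) _
      refine Nat.le_of_mul_le_mul_left (c := (m + 1).factorial) ?_ (Nat.factorial_pos _)
      calc (m + 1).factorial * (2 * (e * (k - 1 + m).choose m))
          ≤ (m + 1).factorial * (2 * (e * k ^ m)) := by gcongr
        _ = k ^ m * (2 * (m + 1).factorial * e) := by ring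
        _ ≤ _ := (h3.trans h5).trans h4
    · have hk1 : (1 : ℝ) ≤ ⌊x / N⌋₊ := by
        exact_mod_cast Nat.one_le_floor_iff _ |>.mpr hge
      have := Nat.lt_floor_add_one (x / N)
      have h2 : x / N ≤ 2 * ⌊x / N⌋₊ := by linarith
      rw [div_le_iff₀ (by linarith)] at h2
      linarith

theorem neg_log_le_of_one_le {m d e k₀ ρ μ H : ℕ} {K M δ : ℝ} (he : 1 ≤ e) (hde : e ≤ d)
    (hK : 1 ≤ K) (hM : 2 ≤ M) (hH : 2 ≤ H) (hδ₀ : 0 < δ) (hδ₁ : δ < 1) (hμ₀ : 0 < μ)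
    (hμ : μ ≤ (d + 1) ^ (m + 1)) (hρ : 2 * ρ ≤ μ)
    (hk₀ : (d : ℝ) * ((d : ℝ) / e) ^ (1 / (m : ℝ)) ≤ 4 * (m + 1).factorial * k₀)
    (h : 1 ≤ 2 ^ μ * (μ.factorial * (K * M ^ d * (e * 4 ^ m)) ^ μ * (√δ ^ k₀) ^ (μ - ρ)) *
      ((H : ℝ) ^ ((m + 1) * d)) ^ μ) :
    -Real.log δ ≤ (16 * (m + 1).factorial * (7 * m + 5) : ℝ) *
      ((d : ℝ)⁻¹ * Real.log (K * e) + Real.log M + Real.log H) *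
        ((e : ℝ) / d) ^ (1 / (m : ℝ)) := by
  have he' : (0 : ℝ) < e := by exact_mod_cast he
  have hd1 : (1 : ℝ) ≤ d := by exact_mod_cast he.trans hde
  have hd' : (0 : ℝ) < d := by linarith
  have hK' : 0 < K := by linarith
  have hM' : 0 < M := by linarith
  have hH2 : (2 : ℝ) ≤ H := by exact_mod_cast hH
  have hH' : (0 : ℝ) < H := by linarith
  have hμ' : (0 : ℝ) < μ := by exact_mod_cast hμ₀
  have hfac : (0 : ℝ) < μ.factorial := by exact_mod_cast Nat.factorial_pos _
  have hsδ : 0 < √δ := Real.sqrt_pos.mpr hδ₀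
  have hl : 0 < -Real.log δ := neg_pos.mpr (Real.log_neg hδ₀ hδ₁)
  have hlogfac : Real.log μ.factorial ≤ μ * Real.log μ := by
    rw [← Real.log_pow]
    exact Real.log_le_log hfac (by exact_mod_cast Nat.factorial_le_pow μ)
  have hlogμ : Real.log μ ≤ (m + 1) * d := by
    have h1 : Real.log μ ≤ Real.log (((d : ℝ) + 1) ^ (m + 1)) :=
      Real.log_le_log hμ' (by exact_mod_cast hμ)
    rw [Real.log_pow] at h1
    have h2 := Real.log_le_sub_one_of_pos (show (0 : ℝ) < d + 1 by linarith)
    rw [add_sub_cancel_right] at h2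
    push_cast at h1
    exact h1.trans (by gcongr)
  have hlog := Real.log_nonneg h
  rw [Real.log_mul (by positivity) (by positivity), Real.log_mul (by positivity) (by positivity),
    Real.log_mul (by positivity) (by positivity), Real.log_mul (by positivity) (by positivity),
    Real.log_pow, Real.log_pow, Real.log_pow, Real.log_pow, Real.log_pow, Real.log_pow,
    show K * M ^ d * (e * 4 ^ m) = (K * e) * M ^ d * 4 ^ m by ring,
    Real.log_mul (by positivity) (by positivity), Real.log_mul (by positivity) (by positivity),
    Real.log_pow, Real.log_pow, Real.log_sqrt hδ₀.le,
    show (4 : ℝ) = 2 ^ 2 by norm_num, Real.log_pow] at hlog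
  have hhalf : (μ : ℝ) / 2 ≤ ((μ - ρ : ℕ) : ℝ) := by
    rw [Nat.cast_sub (by omega)]
    have : (2 : ℝ) * ρ ≤ μ := by exact_mod_cast hρ
    linarith
  have hlogKe : 0 ≤ Real.log (K * e) := by
    have : (1 : ℝ) ≤ e := by exact_mod_cast he
    exact Real.log_nonneg (one_le_mul_of_one_le_of_one_le hK this)
  have hlogM : 0 ≤ Real.log M := Real.log_nonneg (by linarith)
  have hlog2 : (1 : ℝ) / 2 ≤ Real.log 2 := by linarith [Real.log_two_gt_d9]
  have hlog2' : Real.log 2 ≤ 1 := by linarith [Real.log_two_lt_d9]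
  have hlogH : (1 : ℝ) / 2 ≤ Real.log H := hlog2.trans (Real.log_le_log (by norm_num) hH2)
  set S : ℝ := (d : ℝ)⁻¹ * Real.log (K * e) + Real.log M + Real.log H with hS
  have hdS : d * S = Real.log (K * e) + d * Real.log M + d * Real.log H := by
    rw [hS]; field_simp
  have hkey : (k₀ : ℝ) * -Real.log δ / 4 ≤ (7 * m + 5) * (d * S) := by
    have h1 : (μ : ℝ) * (k₀ * -Real.log δ / 4) ≤ ((μ - ρ : ℕ) : ℝ) * (k₀ * -Real.log δ / 2) := by
      have : 0 ≤ (k₀ : ℝ) * -Real.log δ / 2 := by positivity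
      nlinarith
    have h2 : (μ : ℝ) * (k₀ * -Real.log δ / 4) ≤ μ * (Real.log 2 + Real.log μ +
        (Real.log (K * e) + d * Real.log M + m * (2 * Real.log 2)) +
        (m + 1) * d * Real.log H) := by
      push_cast at hlog
      linarith
    have h3 := le_of_mul_le_mul_left h2 hμ'
    refine h3.trans ?_
    rw [hdS]
    have hm0 : (0 : ℝ) ≤ m := Nat.cast_nonneg m
    have h4 : Real.log 2 ≤ d := hlog2'.trans hd1
    have h5 : m * (2 * Real.log 2) ≤ 2 * m * d := by nlinarith
    have h6 : (3 * m + 2) * d * (1 / 2) ≤ (3 * m + 2) * d * Real.log H := by gcongr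
    have h7 : 0 ≤ d * Real.log M := by positivity
    linarith [mul_nonneg hm0 h7, mul_nonneg hm0 hlogKe]
  set y : ℝ := ((e : ℝ) / d) ^ (1 / (m : ℝ)) with hy
  have hy0 : 0 < y := by positivity
  have hxy : ((d : ℝ) / e) ^ (1 / (m : ℝ)) = y⁻¹ := by
    rw [hy, ← Real.inv_rpow (by positivity), inv_div]
  rw [hxy] at hk₀
  have h1 : d * y⁻¹ * -Real.log δ ≤ 4 * (m + 1).factorial * k₀ * -Real.log δ := by gcongr
  have h2 : (4 * (m + 1).factorial * 4 : ℝ) * (k₀ * -Real.log δ / 4) ≤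
      (4 * (m + 1).factorial * 4 : ℝ) * ((7 * m + 5) * (d * S)) := by gcongr
  have h3 : d * y⁻¹ * -Real.log δ ≤ 16 * (m + 1).factorial * (7 * m + 5) * S * d := by linarith
  have h4 : d * (-Real.log δ) ≤ d * (16 * (m + 1).factorial * (7 * m + 5) * S * y) := by
    have := mul_le_mul_of_nonneg_right h3 hy0.le
    calc d * (-Real.log δ) = d * y⁻¹ * -Real.log δ * y := by field_simp
      _ ≤ _ := this
      _ = _ := by ring
  exact le_of_mul_le_mul_left h4 hd'

/-- Exponents of the monomials of degree at most `d` in the variables `Fin (m + 1)`. -/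
def exponents (m d : ℕ) : Finset (Fin (m + 1) →₀ ℕ) :=
  (Finset.range (d + 1)).biUnion fun k => Finset.finsuppAntidiag Finset.univ k

theorem mem_exponents {m d : ℕ} {β : Fin (m + 1) →₀ ℕ} :
    β ∈ exponents m d ↔ ∑ i, β i ≤ d := by
  simp [exponents, Finset.mem_finsuppAntidiag]

theorem card_exponents (m d : ℕ) :
    (exponents m d).card = (d + (m + 1)).choose (m + 1) := by
  rw [exponents, Finset.card_biUnion]
  · rw [← add_assoc, ← Nat.sum_range_add_choose d m]
    refine Finset.sum_congr rfl fun k _ => ?_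
    rw [Finset.card_finsuppAntidiag_nat_eq_choose, Finset.card_univ, Fintype.card_fin,
      show m + 1 + k - 1 = m + k by omega, add_comm k m, Nat.choose_symm_add]
  · intro k _ l _ hkl
    rw [Function.onFun, Finset.disjoint_left]
    intro β hk hl
    rw [Finset.mem_finsuppAntidiag] at hk hl
    exact hkl (hk.1.symm.trans hl.1)

theorem exists_polynomial_of_relation {m d : ℕ} (a : exponents m d → ℂ) (ha : a ≠ 0) :
    ∃ P : MvPolynomial (Fin (m + 1)) ℂ, P ≠ 0 ∧ P.totalDegree ≤ d ∧
      ∀ w : Fin (m + 1) → ℂ, MvPolynomial.eval w P = ∑ β, a β * ∏ k, w k ^ β.1 k := by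
  classical
  refine ⟨∑ β, MvPolynomial.monomial β.1 (a β), ?_, ?_, fun w => ?_⟩
  · obtain ⟨β, hβ⟩ := Function.ne_iff.mp ha
    intro h
    have := congrArg (MvPolynomial.coeff β.1) h
    simp only [MvPolynomial.coeff_sum, MvPolynomial.coeff_monomial, Subtype.coe_inj,
      Finset.sum_ite_eq', Finset.mem_univ, if_true, MvPolynomial.coeff_zero] at this
    exact hβ this
  · refine MvPolynomial.totalDegree_finsetSum_le fun β _ => ?_
    refine (MvPolynomial.totalDegree_monomial_le _ _).trans ?_
    rw [Finsupp.sum_fintype _ _ (fun _ => rfl)]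
    exact mem_exponents.mp β.2
  · simp [MvPolynomial.eval_monomial, Finsupp.prod_fintype]

theorem exists_differentiableOn_prod_pow {n : ℕ} {κ : Type*} [Fintype κ]
    {f : κ → (Fin n → ℂ) → ℂ} {A : Set (Fin n → ℂ)}
    (hf : ∀ i, ∃ V : Set (Fin n → ℂ), IsOpen V ∧ A ⊆ V ∧ DifferentiableOn ℂ (f i) V)
    (β : κ → ℕ) :
    ∃ V : Set (Fin n → ℂ), IsOpen V ∧ A ⊆ V ∧
      DifferentiableOn ℂ (fun z => ∏ k, f k z ^ β k) V := by
  choose V hVo hAV hV using hf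
  refine ⟨⋂ k, V k, isOpen_iInter_of_finite hVo, Set.subset_iInter hAV, ?_⟩
  have hprod : DifferentiableOn ℂ (∏ k, f k ^ β k) (⋂ k, V k) :=
    Finset.prod_induction _ (fun h => DifferentiableOn ℂ h (⋂ k, V k))
      (fun _ _ h₁ h₂ => h₁.mul h₂) (differentiableOn_const 1)
      fun k _ => ((hV k).mono (Set.iInter_subset V k)).pow _
  exact hprod.congr fun z _ => by simp

theorem hypersurface_selection (m : ℕ) (hm : 1 ≤ m) :
    ∃ C₁ > (0 : ℝ), ∀ n : ℕ, 1 ≤ n →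
      ∀ rΔ rΔ' : Fin n → ℝ, (∀ i, 0 < rΔ i) → (∀ i, 0 < rΔ' i) →
      polydisc0 rΔ ⊆ polydisc0 rΔ' →
      ∀ ℳ : Set (Fin n → ℕ), IsCoideal ℳ →
      ∀ K : ℝ, 1 ≤ K →
      ∀ X : Set (Fin n → ℂ),
      AdmitsDecomposition X ℳ (polydisc0 rΔ) (polydisc0 rΔ') K →
      ∀ e : ℕ, 1 ≤ e →
      (∀ k : ℕ, ({α ∈ ℳ | (∑ i, α i) = k}).ncard ≤ e * L m k) →
      ∀ δ : ℝ, 0 < δ → δ < 1 / 2 →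
      ∀ rD : Fin n → ℝ, (∀ i, 0 < rD i) →
      (fun z => (δ⁻¹ : ℂ) • z) '' polydisc0 rD ⊆ polydisc0 rΔ →
      ∀ M : ℝ, 2 ≤ M →
      ∀ f : Fin (m + 1) → (Fin n → ℂ) → ℂ,
      (∀ i, ∃ V : Set (Fin n → ℂ), IsOpen V ∧ closure (polydisc0 rΔ') ⊆ V ∧
        DifferentiableOn ℂ (f i) V) →
      (∀ i, ∀ z ∈ polydisc0 rΔ', ‖f i z‖ ≤ M) →
      ∀ H : ℕ, 2 ≤ H → ∀ d : ℕ, e ≤ d →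
      -Real.log δ > C₁ * ((d : ℝ)⁻¹ * Real.log (K * (e : ℝ)) + Real.log M +
        Real.log (H : ℝ)) * ((e : ℝ) / (d : ℝ)) ^ (1 / (m : ℝ)) →
      ∃ P : MvPolynomial (Fin (m + 1)) ℂ, P ≠ 0 ∧ P.totalDegree ≤ d ∧
        ∀ z ∈ X ∩ polydisc0 rD,
          (∀ i, ∃ q : ℚ, ratHeight q ≤ H ∧ f i z = (q : ℂ)) →
          MvPolynomial.eval (fun i => f i z) P = 0 := by
  classical
  refine ⟨16 * (m + 1).factorial * (7 * m + 5), by positivity, ?_⟩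
  intro n _ rΔ rΔ' _ hrΔ' _ ℳ _ K hK X hX e he hcount δ hδ₀ hδ₁ rD _ hD M hM f hf hfM H hH d
    hde hlog
  let σ := {z : Fin n → ℂ // z ∈ X ∩ polydisc0 rD ∧
    ∀ i, ∃ q : ℚ, ratHeight q ≤ H ∧ f i z = (q : ℂ)}
  let g : exponents m d → (Fin n → ℂ) → ℂ := fun β z => ∏ k, f k z ^ β.1 k
  rcases exists_relation_or_det_ne_zero (fun β (z : σ) => g β z) with ⟨a, ha, hrel⟩ | ⟨p, hp⟩
  · obtain ⟨P, hP0, hPd, hP⟩ := exists_polynomial_of_relation a ha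
    exact ⟨P, hP0, hPd, fun z hz hq => (hP _).trans (hrel ⟨z, hz, hq⟩)⟩
  exfalso
  have hpΔ : ∀ j, (δ⁻¹ : ℂ) • (p j).1 ∈ polydisc0 rΔ := fun j =>
    hD ⟨_, (p j).2.1.2, rfl⟩
  have hpX : ∀ j, (p j).1 ∈ X ∩ polydisc0 rΔ := by
    refine fun j => ⟨(p j).2.1.1, fun i => ?_⟩
    have h := hpΔ j i
    rw [Pi.smul_apply, smul_eq_mul, norm_mul, norm_inv, Complex.norm_real,
      Real.norm_of_nonneg hδ₀.le] at h
    refine lt_of_le_of_lt (le_mul_of_one_le_left (norm_nonneg _) ?_) h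
    exact (one_le_inv₀ hδ₀).mpr (by linarith)
  have hgM : ∀ β, ∀ z ∈ polydisc0 rΔ', ‖g β z‖ ≤ M ^ d := by
    intro β z hz
    rw [norm_prod]
    calc ∏ k, ‖f k z ^ β.1 k‖ ≤ ∏ k, M ^ β.1 k := by
          refine Finset.prod_le_prod (fun _ _ => norm_nonneg _) fun k _ => ?_
          rw [norm_pow]
          exact pow_le_pow_left₀ (norm_nonneg _) (hfM k z hz) _
      _ = M ^ ∑ k, β.1 k := Finset.prod_pow_eq_pow_sum _ _ _
      _ ≤ M ^ d := pow_le_pow_right₀ (by linarith) (mem_exponents.mp β.2)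
  obtain ⟨k₀, hρ, hk₀⟩ := exists_truncation_degree hm he hde
  have hupper := norm_det_le_of_admitsDecomposition hm (by linarith)
    ⟨0, fun i => by simpa using hrΔ' i⟩ hX hcount hδ₀ hδ₁ g
    (fun β => exists_differentiableOn_prod_pow hf β.1) (by positivity) hgM
    (fun j => (p j).1) hpX hpΔ k₀
  choose q hqH hq using fun j => (p j).2.2
  have hmat : (Matrix.of fun j β => g β (p j).1) =
      Matrix.of fun (j β : exponents m d) => ∏ k, (q j k : ℂ) ^ β.1 k := by
    ext j β
    simp only [Matrix.of_apply, g, hq]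
  rw [hmat] at hupper hp
  have hlower := one_le_norm_det_mul_of_ratHeight_le q (fun β k => β.1 k) (d := d) hqH
    (fun β k => (Finset.single_le_sum (fun _ _ => Nat.zero_le _) (Finset.mem_univ k)).trans
      (mem_exponents.mp β.2)) hp
  have hone := hlower.trans (mul_le_mul_of_nonneg_right hupper (by positivity))
  rw [Fintype.card_coe, card_exponents, Fintype.card_fin] at hone
  refine absurd (neg_log_le_of_one_le he hde hK hM hH hδ₀ (by linarith) ?_ ?_ hρ hk₀ hone)
    (not_le.mpr hlog)
  · exact Nat.choose_pos (by omega)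
  · exact add_choose_le_succ_pow d (m + 1)
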